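/- Let L be a convex cone of real random variables on (Ω, 𝒜, P₀) and Y : Ω → [1, ∞) a measurable function such that for each X ∈ L there is λ > 0 with |X| ≤ λ·Y P₀-a.s. Suppose that for every ε > 0 there is c > 0 such that P₀(|X| > c·Y) < ε for every X ∈ L with X ≥ −Y P₀-a.s. Then there exists a monotone normalized linear functional T : B → ℝ with T ~ P₀, T(1/Y) > 0, and such that T(h) ≤ 0 for every X ∈ L and every bounded measurable h : Ω → ℝ with h = X/Y P₀-a.s. -/

import Mathlib

open MeasureTheory Filter Topology

/-- A bounded measurable real function on `Ω`: an element of the space `B`. -/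
def IsBddMeas {Ω : Type*} [MeasurableSpace Ω] (f : Ω → ℝ) : Prop :=
  Measurable f ∧ ∃ M : ℝ, ∀ ω, |f ω| ≤ M

/-- A finitely additive probability on `𝒜`, encoded as a functional on functions
`Ω → ℝ` that is linear and monotone on the space `B` of bounded measurable functions
and normalized (`ℓ(1) = 1`). -/
def IsFAP {Ω : Type*} [MeasurableSpace Ω] (ℓ : (Ω → ℝ) → ℝ) : Prop :=
  (∀ f g : Ω → ℝ, IsBddMeas f → IsBddMeas g → ℓ (f + g) = ℓ f + ℓ g) ∧
  (∀ (c : ℝ) (f : Ω → ℝ), IsBddMeas f → ℓ (c • f) = c * ℓ f) ∧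
  (∀ f g : Ω → ℝ, IsBddMeas f → IsBddMeas g → (∀ ω, f ω ≤ g ω) → ℓ f ≤ ℓ g) ∧
  ℓ (fun _ => 1) = 1

section FinitelyAdditive

variable {Ω : Type*} [MeasurableSpace Ω]

lemma IsBddMeas.add {f g : Ω → ℝ} (hf : IsBddMeas f) (hg : IsBddMeas g) :
    IsBddMeas (f + g) := by
  obtain ⟨hfm, M, hM⟩ := hf
  obtain ⟨hgm, N, hN⟩ := hg
  exact ⟨hfm.add hgm, M + N, fun ω => (abs_add_le _ _).trans (add_le_add (hM ω) (hN ω))⟩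

lemma IsBddMeas.smul (c : ℝ) {f : Ω → ℝ} (hf : IsBddMeas f) : IsBddMeas (c • f) := by
  obtain ⟨hfm, M, hM⟩ := hf
  refine ⟨hfm.const_smul c, |c| * M, fun ω => ?_⟩
  simpa [abs_mul] using mul_le_mul_of_nonneg_left (hM ω) (abs_nonneg c)

lemma IsBddMeas.const (c : ℝ) : IsBddMeas (fun _ : Ω => c) :=
  ⟨measurable_const, |c|, fun _ => le_rfl⟩

lemma IsBddMeas.indicator_one {A : Set Ω} (hA : MeasurableSet A) :
    IsBddMeas (A.indicator fun _ => (1 : ℝ)) := by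
  refine ⟨measurable_const.indicator hA, 1, fun ω => ?_⟩
  by_cases h : ω ∈ A <;> simp [h]

lemma IsBddMeas.integrable {f : Ω → ℝ} (hf : IsBddMeas f) (P : Measure Ω)
    [IsFiniteMeasure P] : Integrable f P :=
  .of_bound hf.1.aestronglyMeasurable hf.2.choose (.of_forall hf.2.choose_spec)

variable (Ω) in
/-- The real vector space of bounded measurable functions. -/
def bddMeas : Submodule ℝ (Ω → ℝ) where
  carrier := {f | IsBddMeas f}
  add_mem' := IsBddMeas.add
  zero_mem' := IsBddMeas.const 0
  smul_mem' c _ := IsBddMeas.smul c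

lemma exists_linearMap_add_nonneg_of_pointedCone {E : Type*} [AddCommGroup E] [Module ℝ E]
    (S : PointedCone ℝ (E × ℝ)) (hpos : ∀ r : ℝ, ((0 : E), r) ∈ S → 0 ≤ r)
    (hfull : ∀ f : E, ∃ r : ℝ, (f, r) ∈ S) :
    ∃ τ : E →ₗ[ℝ] ℝ, ∀ f r, (f, r) ∈ S → 0 ≤ τ f + r := by
  let V : Submodule ℝ (E × ℝ) := LinearMap.ker (LinearMap.fst ℝ E ℝ)
  obtain ⟨g, hg, hgS⟩ := riesz_extension S ⟨V, (LinearMap.snd ℝ E ℝ).comp V.subtype⟩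
    (by
      rintro ⟨⟨f, r⟩, hf⟩ hS
      obtain rfl : f = 0 := by simpa [V] using hf
      exact hpos r hS)
    (by
      rintro ⟨f, r⟩
      obtain ⟨r', hr'⟩ := hfull f
      exact ⟨⟨(0, r' - r), by simp [V]⟩, by simpa using hr'⟩)
  refine ⟨g.comp (LinearMap.inl ℝ E ℝ), fun f r hfr => ?_⟩
  have h1 : g (0, r) = r := hg ⟨(0, r), by simp [V]⟩
  have h2 := hgS _ hfr
  rw [show (f, r) = (f, (0 : ℝ)) + (0, r) by simp, map_add, h1] at h2
  simpa using h2

lemma mul_sub_le_integral_of_tail_le (P : Measure Ω) [IsProbabilityMeasure P] {Z b : Ω → ℝ}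
    (hZ : Measurable Z) (hb : Integrable b P) (hb0 : ∀ᵐ ω ∂P, 0 ≤ b ω) {t a ε : ℝ}
    (ht : 0 ≤ t) (hε0 : 0 ≤ ε) (ha : 0 ≤ a) (htb : ∀ᵐ ω ∂P, t - Z ω ≤ b ω)
    (htail : P.real {ω | a < Z ω} ≤ ε) : (1 - ε) * t - a ≤ ∫ ω, b ω ∂P := by
  rcases le_total t a with hta | hat
  · have := integral_nonneg_of_ae hb0
    nlinarith
  · have hm : MeasurableSet {ω | a < Z ω} := measurableSet_lt measurable_const hZ
    have h1 : ∫ ω, {ω | a < Z ω}ᶜ.indicator (fun _ => t - a) ω ∂P ≤ ∫ ω, b ω ∂P := by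
      refine integral_mono_ae ((integrable_const _).indicator hm.compl) hb ?_
      filter_upwards [hb0, htb] with ω h0 h
      by_cases hω : a < Z ω
      · simpa [hω] using h0
      · simp only [Set.indicator, Set.mem_compl_iff, Set.mem_ofPred_eq, hω, not_false_eq_true,
          if_true]
        linarith
    rw [integral_indicator_const _ hm.compl, probReal_compl_eq_one_sub hm, smul_eq_mul] at h1
    nlinarith

/-- The cone of pairs `(f, r)` such that `f ≥ t - Z - b` and `f ≥ -s - Z` almost surely and
`r ≥ ∫ b - (1 - ε) t + c s` for some `Z ∈ D`, bounded `b ≥ 0` and `t, s ≥ 0`. -/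
def tailCone (P : Measure Ω) [IsFiniteMeasure P] (D : Set (Ω → ℝ)) (h0 : (0 : Ω → ℝ) ∈ D)
    (hadd : ∀ X ∈ D, ∀ Z ∈ D, X + Z ∈ D) (hsmul : ∀ X ∈ D, ∀ c : ℝ, 0 ≤ c → c • X ∈ D)
    (ε c : ℝ) : PointedCone ℝ (bddMeas Ω × ℝ) where
  carrier := {x | ∃ Z ∈ D, ∃ b : Ω → ℝ, ∃ t s : ℝ, IsBddMeas b ∧ (∀ᵐ ω ∂P, 0 ≤ b ω) ∧
    0 ≤ t ∧ 0 ≤ s ∧ (∀ᵐ ω ∂P, t - Z ω - b ω ≤ x.1.1 ω) ∧ (∀ᵐ ω ∂P, -s - Z ω ≤ x.1.1 ω) ∧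
    ∫ ω, b ω ∂P - (1 - ε) * t + c * s ≤ x.2}
  zero_mem' := ⟨0, h0, 0, 0, 0, IsBddMeas.const 0, by simp, le_rfl, le_rfl, by simp, by simp,
    by simp⟩
  add_mem' := by
    rintro x y ⟨Z, hZ, b, t, s, hb, hb0, ht, hs, h1, h2, h3⟩
      ⟨Z', hZ', b', t', s', hb', hb0', ht', hs', h1', h2', h3'⟩
    refine ⟨Z + Z', hadd _ hZ _ hZ', b + b', t + t', s + s', hb.add hb', ?_, by positivity,
      by positivity, ?_, ?_, ?_⟩
    · filter_upwards [hb0, hb0'] with ω h h' using add_nonneg h h'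
    · filter_upwards [h1, h1'] with ω h h'
      simp only [Pi.add_apply, Prod.fst_add, Submodule.coe_add]
      linarith
    · filter_upwards [h2, h2'] with ω h h'
      simp only [Pi.add_apply, Prod.fst_add, Submodule.coe_add]
      linarith
    · simp only [Pi.add_apply, Prod.snd_add]
      rw [integral_add (hb.integrable P) (hb'.integrable P)]
      linarith
  smul_mem' := by
    rintro ⟨k, hk⟩ x ⟨Z, hZ, b, t, s, hb, hb0, ht, hs, h1, h2, h3⟩
    refine ⟨k • Z, hsmul _ hZ k hk, k • b, k * t, k * s, hb.smul k, ?_, by positivity,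
      by positivity, ?_, ?_, ?_⟩
    · filter_upwards [hb0] with ω h using mul_nonneg hk h
    · filter_upwards [h1] with ω h
      have := mul_le_mul_of_nonneg_left h hk
      change k * t - k * Z ω - k * b ω ≤ k * x.1.1 ω
      linarith
    · filter_upwards [h2] with ω h
      have := mul_le_mul_of_nonneg_left h hk
      change -(k * s) - k * Z ω ≤ k * x.1.1 ω
      linarith
    · have := mul_le_mul_of_nonneg_left h3 hk
      change ∫ ω, k * b ω ∂P - (1 - ε) * (k * t) + c * (k * s) ≤ k * x.2
      rw [integral_const_mul]
      linarith

lemma exists_charge_ge_sub (P : Measure Ω) [IsProbabilityMeasure P] (D : Set (Ω → ℝ))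
    (hmeas : ∀ X ∈ D, Measurable X) (h0 : (0 : Ω → ℝ) ∈ D)
    (hadd : ∀ X ∈ D, ∀ Z ∈ D, X + Z ∈ D) (hsmul : ∀ X ∈ D, ∀ c : ℝ, 0 ≤ c → c • X ∈ D)
    {ε c : ℝ} (hε : 0 ≤ ε) (hc : 0 ≤ c)
    (htight : ∀ X ∈ D, (∀ᵐ ω ∂P, -1 ≤ X ω) → P.real {ω | c < X ω} ≤ ε) :
    ∃ τ : (Ω → ℝ) →ₗ[ℝ] ℝ, (∀ f, IsBddMeas f → (∀ᵐ ω ∂P, 0 ≤ f ω) → 0 ≤ τ f) ∧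
      (∀ X ∈ D, ∀ h, IsBddMeas h → (∀ᵐ ω ∂P, h ω = X ω) → τ h ≤ 0) ∧
      (∀ A, MeasurableSet A → P.real A - ε ≤ τ (A.indicator fun _ => (1 : ℝ))) ∧
      τ (fun _ => 1) ≤ 1 + c := by
  let S := tailCone P D h0 hadd hsmul ε c
  obtain ⟨σ, hσ⟩ := exists_linearMap_add_nonneg_of_pointedCone S
    (by
      rintro r ⟨Z, hZ, b, t, s, hb, hb0, ht, hs, h1, h2, h3⟩
      refine le_trans ?_ h3
      have key : ∀ s', s < s' → 0 ≤ ∫ ω, b ω ∂P - (1 - ε) * t + c * s' := by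
        intro s' hs'
        have hs0 : 0 < s' := hs.trans_lt hs'
        have htail := htight _ (hsmul Z hZ s'⁻¹ (inv_nonneg.2 hs0.le)) (by
          filter_upwards [h2] with ω h
          have h : -s - Z ω ≤ 0 := h
          simp only [Pi.smul_apply, smul_eq_mul]
          rw [inv_mul_eq_div, le_div_iff₀ hs0]
          linarith)
        have heq : {ω | c < (s'⁻¹ • Z) ω} = {ω | c * s' < Z ω} := by
          ext ω
          simp only [Pi.smul_apply, smul_eq_mul, Set.mem_ofPred_eq]
          rw [inv_mul_eq_div, lt_div_iff₀ hs0]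
        rw [heq] at htail
        have := mul_sub_le_integral_of_tail_le P (hmeas Z hZ) (hb.integrable P) hb0 ht hε
          (by positivity) (by
            filter_upwards [h1] with ω h
            have h : t - Z ω - b ω ≤ 0 := h
            linarith) htail
        linarith
      have hlim : Tendsto (fun s' => ∫ ω, b ω ∂P - (1 - ε) * t + c * s') (𝓝[>] s)
          (𝓝 (∫ ω, b ω ∂P - (1 - ε) * t + c * s)) := by
        apply tendsto_nhdsWithin_of_tendsto_nhds
        exact Continuous.tendsto (by fun_prop) s
      exact ge_of_tendsto hlim (eventually_mem_nhdsWithin.mono key))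
    (by
      rintro ⟨f, hf⟩
      obtain ⟨M, hM⟩ := hf.2
      refine ⟨|M| + c * |M|, 0, h0, fun _ => |M|, 0, |M|, IsBddMeas.const _, by simp, le_rfl,
        abs_nonneg _, .of_forall fun ω => ?_, .of_forall fun ω => ?_, by simp⟩ <;>
      · have := neg_le_of_abs_le ((hM ω).trans (le_abs_self M))
        simpa using this)
  obtain ⟨τ, hτ⟩ := σ.exists_extend
  have hτσ : ∀ (f) (hf : IsBddMeas f), τ f = σ ⟨f, hf⟩ := fun f hf =>
    DFunLike.congr_fun hτ ⟨f, hf⟩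
  have hS : ∀ (f) (hf : IsBddMeas f) (r : ℝ), ((⟨f, hf⟩ : bddMeas Ω), r) ∈ S → 0 ≤ τ f + r :=
    fun f hf r h => hτσ f hf ▸ hσ _ r h
  refine ⟨τ, fun f hf hf0 => ?_, fun X hX h hh hhX => ?_, fun A hA => ?_, ?_⟩
  · have := hS f hf 0 ⟨0, h0, 0, 0, 0, IsBddMeas.const 0, by simp, le_rfl, le_rfl,
      by simpa using hf0, by simpa using hf0, by simp⟩
    simpa using this
  · have := hS ((-1 : ℝ) • h) (hh.smul _) 0 ⟨X, hX, 0, 0, 0, IsBddMeas.const 0, by simp, le_rfl,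
      le_rfl, by filter_upwards [hhX] with ω hω; simp [hω],
      by filter_upwards [hhX] with ω hω; simp [hω], by simp⟩
    rw [map_smul, smul_eq_mul] at this
    linarith
  · have := hS _ (IsBddMeas.indicator_one hA) (-(P.real A - ε)) ⟨0, h0,
      Aᶜ.indicator fun _ => 1, 1, 0, IsBddMeas.indicator_one hA.compl,
      .of_forall fun ω => Set.indicator_nonneg (fun _ _ => zero_le_one) ω, zero_le_one, le_rfl,
      .of_forall fun ω => by by_cases h : ω ∈ A <;> simp [h],
      .of_forall fun ω => by by_cases h : ω ∈ A <;> simp [h], by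
        rw [integral_indicator_const _ hA.compl, probReal_compl_eq_one_sub hA, smul_eq_mul]
        linarith⟩
    linarith
  · have := hS ((-1 : ℝ) • fun _ => 1) ((IsBddMeas.const 1).smul _) (1 + c) ⟨0, h0,
      fun _ => 1, 0, 1, IsBddMeas.const 1, by simp, le_rfl, zero_le_one, by simp, by simp,
      by simp⟩
    rw [map_smul, smul_eq_mul] at this
    linarith

/-- A convex cone of functions that is tight on its elements bounded below by `-1` admits an
equivalent finitely additive probability giving its bounded elements nonpositive mass. -/
lemma exists_equivalent_charge (P : Measure Ω) [IsProbabilityMeasure P] (D : Set (Ω → ℝ))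
    (hmeas : ∀ X ∈ D, Measurable X) (h0 : (0 : Ω → ℝ) ∈ D)
    (hadd : ∀ X ∈ D, ∀ Z ∈ D, X + Z ∈ D) (hsmul : ∀ X ∈ D, ∀ c : ℝ, 0 ≤ c → c • X ∈ D)
    (htight : ∀ ε : ℝ, 0 < ε → ∃ c : ℝ, 0 ≤ c ∧
      ∀ X ∈ D, (∀ᵐ ω ∂P, -1 ≤ X ω) → P.real {ω | c < X ω} ≤ ε) :
    ∃ T : (Ω → ℝ) → ℝ, IsFAP T ∧
      (∀ A : Set Ω, MeasurableSet A →
        (T (A.indicator fun _ => (1 : ℝ)) = 0 ↔ P A = 0)) ∧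
      ∀ X ∈ D, ∀ h : Ω → ℝ, IsBddMeas h → (∀ᵐ ω ∂P, h ω = X ω) → T h ≤ 0 := by
  have hex : ∀ n : ℕ, ∃ (c : ℝ) (τ : (Ω → ℝ) →ₗ[ℝ] ℝ), 0 ≤ c ∧
      (∀ f, IsBddMeas f → (∀ᵐ ω ∂P, 0 ≤ f ω) → 0 ≤ τ f) ∧
      (∀ X ∈ D, ∀ h, IsBddMeas h → (∀ᵐ ω ∂P, h ω = X ω) → τ h ≤ 0) ∧
      (∀ A, MeasurableSet A → P.real A - 1 / ((n : ℝ) + 1) ≤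
        τ (A.indicator fun _ => (1 : ℝ))) ∧ τ (fun _ => 1) ≤ 1 + c := fun n => by
    obtain ⟨c, hc, hcD⟩ := htight (1 / ((n : ℝ) + 1)) (by positivity)
    obtain ⟨τ, h⟩ := exists_charge_ge_sub P D hmeas h0 hadd hsmul (by positivity) hc hcD
    exact ⟨c, τ, hc, h⟩
  choose c τ hc hpos hD hlow hone using hex
  let w : ℕ → ℝ := fun n => (1 / 2) ^ n / (1 + c n)
  have hw : ∀ n, 0 < w n := fun n => div_pos (by positivity) (by linarith [hc n])
  have hmono : ∀ n f g, IsBddMeas f → IsBddMeas g → (∀ᵐ ω ∂P, f ω ≤ g ω) → τ n f ≤ τ n g := by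
    intro n f g hf hg hfg
    have := hpos n (g + (-1 : ℝ) • f) (hg.add (hf.smul _)) (by
      filter_upwards [hfg] with ω h
      simpa using h)
    rw [map_add, map_smul, smul_eq_mul] at this
    linarith
  have hsum : ∀ f, IsBddMeas f → Summable fun n => w n * τ n f := by
    intro f hf
    obtain ⟨M, hM⟩ := hf.2
    have hτM : ∀ n, |τ n f| ≤ |M| * (1 + c n) := by
      intro n
      have hM0 := abs_nonneg M
      have hu := hmono n f (|M| • fun _ => 1) hf ((IsBddMeas.const 1).smul _)
        (.of_forall fun ω => by simpa using (le_abs_self _).trans ((hM ω).trans (le_abs_self M)))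
      have hl := hmono n ((-|M|) • fun _ => 1) f ((IsBddMeas.const 1).smul _) hf
        (.of_forall fun ω => by simpa using neg_le_of_abs_le ((hM ω).trans (le_abs_self M)))
      rw [map_smul, smul_eq_mul] at hu hl
      have := mul_le_mul_of_nonneg_left (hone n) hM0
      exact abs_le.2 ⟨by linarith, by linarith⟩
    refine Summable.of_norm_bounded (g := fun n => (1 / 2 : ℝ) ^ n * |M|)
      ((summable_geometric_two).mul_right _) fun n => ?_
    have hcn : 0 < 1 + c n := by linarith [hc n]
    rw [Real.norm_eq_abs, abs_mul, abs_of_pos (hw n)]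
    refine (mul_le_mul_of_nonneg_left (hτM n) (hw n).le).trans_eq ?_
    simp only [w]
    field_simp
  let U : (Ω → ℝ) → ℝ := fun f => ∑' n, w n * τ n f
  have hUmono : ∀ f g, IsBddMeas f → IsBddMeas g → (∀ᵐ ω ∂P, f ω ≤ g ω) → U f ≤ U g :=
    fun f g hf hg h => (hsum f hf).tsum_le_tsum
      (fun n => mul_le_mul_of_nonneg_left (hmono n f g hf hg h) (hw n).le) (hsum g hg)
  have hUpos : ∀ A, MeasurableSet A → P A ≠ 0 → 0 < U (A.indicator fun _ => (1 : ℝ)) := by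
    intro A hA hPA
    have hPA' : 0 < P.real A := ENNReal.toReal_pos hPA (measure_ne_top _ _)
    obtain ⟨n, hn⟩ := exists_nat_one_div_lt hPA'
    have hA' := IsBddMeas.indicator_one hA
    refine (hsum _ hA').tsum_pos (fun m => mul_nonneg (hw m).le (hpos m _ hA' ?_)) n
      (mul_pos (hw n) ((sub_pos.2 hn).trans_le (hlow n A hA)))
    exact .of_forall fun ω => Set.indicator_nonneg (fun _ _ => zero_le_one) ω
  have hU1 : 0 < U (fun _ => 1) := by
    simpa using hUpos Set.univ MeasurableSet.univ (by simp)
  have hUsmul : ∀ (k : ℝ) (f : Ω → ℝ), U (k • f) = k * U f := fun k f => by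
    simp only [U, map_smul, smul_eq_mul, ← tsum_mul_left, mul_left_comm]
  have hUadd : ∀ f g, IsBddMeas f → IsBddMeas g → U (f + g) = U f + U g := fun f g hf hg => by
    simp only [U, map_add, mul_add]
    exact (hsum f hf).tsum_add (hsum g hg)
  refine ⟨fun f => U f / U (fun _ => 1), ⟨fun f g hf hg => ?_, fun k f hf => ?_,
    fun f g hf hg h => ?_, div_self hU1.ne'⟩, fun A hA => ⟨fun h => ?_, fun h => ?_⟩,
    fun X hX h hh hhX => ?_⟩
  · simp only [hUadd f g hf hg, add_div]
  · simp only [hUsmul, mul_div_assoc]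
  · exact div_le_div_of_nonneg_right (hUmono f g hf hg (.of_forall h)) hU1.le
  · by_contra hA0
    exact (div_pos (hUpos A hA hA0) hU1).ne' h
  · have hle := hUmono _ ((0 : ℝ) • fun _ => 1) (IsBddMeas.indicator_one hA)
      ((IsBddMeas.const 1).smul _) (by
        filter_upwards [measure_eq_zero_iff_ae_notMem.1 h] with ω hω
        simp [hω])
    have hge := hUmono ((0 : ℝ) • fun _ => 1) (A.indicator fun _ => 1)
      ((IsBddMeas.const 1).smul _) (IsBddMeas.indicator_one hA)
      (.of_forall fun ω => by simpa using Set.indicator_nonneg (fun _ _ => zero_le_one) ω)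
    rw [hUsmul, zero_mul] at hle hge
    simp [le_antisymm hle hge]
  · exact div_nonpos_of_nonpos_of_nonneg (tsum_nonpos fun n =>
      mul_nonpos_of_nonneg_of_nonpos (hw n).le (hD n X hX h hh hhX)) hU1.le

lemma IsFAP.pos_of_forall_pos {T : (Ω → ℝ) → ℝ} (hT : IsFAP T) (P : Measure Ω)
    [IsProbabilityMeasure P]
    (hequiv : ∀ A, MeasurableSet A → (T (A.indicator fun _ => (1 : ℝ)) = 0 ↔ P A = 0))
    {f : Ω → ℝ} (hf : IsBddMeas f) (hf0 : ∀ ω, 0 < f ω) : 0 < T f := by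
  obtain ⟨-, hsmul, hmono, -⟩ := hT
  obtain ⟨n, hn⟩ : ∃ n : ℕ, P {ω | 1 / ((n : ℝ) + 1) < f ω} ≠ 0 := by
    by_contra! h
    have hcover : (⋃ n : ℕ, {ω | 1 / ((n : ℝ) + 1) < f ω}) = Set.univ :=
      Set.eq_univ_of_forall fun ω => Set.mem_iUnion.2 (exists_nat_one_div_lt (hf0 ω))
    have := measure_iUnion_null h
    rw [hcover] at this
    simp at this
  have hA : MeasurableSet {ω | 1 / ((n : ℝ) + 1) < f ω} := measurableSet_lt measurable_const hf.1
  have hA' := IsBddMeas.indicator_one hA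
  have h0 : T 0 = 0 := by simpa using hsmul 0 _ hf
  have hTA : 0 < T ({ω | 1 / ((n : ℝ) + 1) < f ω}.indicator fun _ => 1) := by
    refine lt_of_le_of_ne ?_ (Ne.symm fun h => hn ((hequiv _ hA).1 h))
    rw [← h0]
    exact hmono _ _ (IsBddMeas.const 0) hA' fun ω =>
      Set.indicator_nonneg (fun _ _ => zero_le_one) ω
  refine lt_of_lt_of_le (mul_pos (by positivity : 0 < 1 / ((n : ℝ) + 1)) hTA) ?_
  rw [← hsmul _ _ hA']
  refine hmono _ _ (hA'.smul _) hf fun ω => ?_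
  rw [Pi.smul_apply, smul_eq_mul]
  by_cases h : ω ∈ {ω | 1 / ((n : ℝ) + 1) < f ω}
  · rw [Set.indicator_of_mem h, mul_one]
    exact h.le
  · rw [Set.indicator_of_notMem h, mul_zero]
    exact (hf0 ω).le

end FinitelyAdditive

/-- **Unbounded case: ESFA for the rescaled cone.**
Let `L` be a convex cone dominated by `Y ≥ 1` and suppose the tightness condition holds:
for each `ε > 0` there is `c > 0` with `P₀(|X| > c·Y) < ε` whenever `X ∈ L` and
`X ≥ −Y` a.s. Then there is a finitely additive probability `T ~ P₀` with `T(1/Y) > 0`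
and `T(X/Y) ≤ 0` for every `X ∈ L`. -/
theorem stmt_13 {Ω : Type*} [MeasurableSpace Ω] (P₀ : Measure Ω) [IsProbabilityMeasure P₀]
    (L : Set (Ω → ℝ)) (hLmeas : ∀ X ∈ L, Measurable X)
    (hLadd : ∀ X ∈ L, ∀ Y ∈ L, X + Y ∈ L)
    (hLsmul : ∀ X ∈ L, ∀ c : ℝ, 0 ≤ c → c • X ∈ L)
    (Y : Ω → ℝ) (hYmeas : Measurable Y) (hY1 : ∀ ω, 1 ≤ Y ω)
    (hdom : ∀ X ∈ L, ∃ lam : ℝ, 0 < lam ∧ ∀ᵐ ω ∂P₀, |X ω| ≤ lam * Y ω)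
    (htight : ∀ ε : ℝ, 0 < ε → ∃ c : ℝ, 0 < c ∧
      ∀ X ∈ L, (∀ᵐ ω ∂P₀, -Y ω ≤ X ω) → (P₀ {ω | c * Y ω < |X ω|}).toReal < ε) :
    ∃ T : (Ω → ℝ) → ℝ, IsFAP T ∧
      (∀ A : Set Ω, MeasurableSet A →
        (T (A.indicator fun _ => (1 : ℝ)) = 0 ↔ P₀ A = 0)) ∧
      0 < T (fun ω => 1 / Y ω) ∧
      ∀ X ∈ L, ∀ h : Ω → ℝ, IsBddMeas h → (∀ᵐ ω ∂P₀, h ω = X ω / Y ω) → T h ≤ 0 := by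
  have hYpos : ∀ ω, 0 < Y ω := fun ω => zero_lt_one.trans_le (hY1 ω)
  have hdiv : ∀ (X : Ω → ℝ) ω, (X / Y) ω = X ω / Y ω := fun _ _ => rfl
  obtain ⟨T, hT, hequiv, hTL⟩ := exists_equivalent_charge P₀ {Z | Z = 0 ∨ ∃ X ∈ L, Z = X / Y}
    (by
      rintro _ (rfl | ⟨X, hX, rfl⟩)
      exacts [measurable_zero, (hLmeas X hX).div hYmeas])
    (Or.inl rfl)
    (by
      rintro _ (rfl | ⟨X, hX, rfl⟩) _ (rfl | ⟨X', hX', rfl⟩)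
      · simp
      · exact Or.inr ⟨X', hX', zero_add _⟩
      · exact Or.inr ⟨X, hX, add_zero _⟩
      · exact Or.inr ⟨X + X', hLadd X hX X' hX', funext fun ω => (add_div _ _ _).symm⟩)
    (by
      rintro _ (rfl | ⟨X, hX, rfl⟩) k hk
      · simp
      · exact Or.inr ⟨k • X, hLsmul X hX k hk, funext fun ω => (mul_div_assoc _ _ _).symm⟩)
    (by
      intro ε hε
      obtain ⟨c, hc, hcL⟩ := htight ε hε
      refine ⟨c, hc.le, ?_⟩
      rintro _ (rfl | ⟨X, hX, rfl⟩) hlow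
      · simp [hc.le.not_gt, hε.le]
      · refine le_trans (measureReal_mono fun ω hω => ?_) (hcL X hX ?_).le
        · rw [Set.mem_ofPred_eq, hdiv, lt_div_iff₀ (hYpos ω)] at hω
          exact hω.trans_le (le_abs_self _)
        · filter_upwards [hlow] with ω h
          rw [hdiv, le_div_iff₀ (hYpos ω)] at h
          linarith)
  refine ⟨T, hT, hequiv, hT.pos_of_forall_pos P₀ hequiv ?_ fun ω => one_div_pos.2 (hYpos ω),
    fun X hX h hh hhX => hTL (X / Y) (Or.inr ⟨X, hX, rfl⟩) h hh hhX⟩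
  refine ⟨measurable_const.div hYmeas, 1, fun ω => ?_⟩
  rw [abs_of_pos (one_div_pos.2 (hYpos ω))]
  exact div_le_one_of_le₀ (hY1 ω) (hYpos ω).le
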